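/- arXiv:1307.3862 — 2 statements merged into one kernel-verified Lean document; each statement's English description precedes it below -/
import Mathlib

section
/- Let 0 ≤ m ≤ n and −m ≤ k ≤ m be integers, and let c = (c_m, c_{m+1}, …, c_n) ∈ ℂ^{n−m+1}. Then (1/2)∫₀^π cosθ · |Σ_{l=m}^n c_l p_{l−|k|}^{(|k|)}(cosθ)|² · sin^{2|k|+1}θ dθ = c^H J(|k|)_{n−|k|}^{m−|k|} c; equivalently, ε(Σ_{l=m}^n c_l Y_l^k) = c^H J(|k|)_{n−|k|}^{m−|k|} c. -/
open MeasureTheory Finset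

noncomputable section

namespace SFT

/-- The recurrence coefficients `b_l^{(α)}` of the orthonormal ultraspherical polynomials. -/
def b (α : ℝ) : ℕ → ℝ
  | 0 => Real.sqrt (Real.sqrt Real.pi * Real.Gamma (α + 1) / (2 * Real.Gamma (α + 3 / 2)))
  | l + 1 => Real.sqrt ((((l : ℝ) + 1) * (((l : ℝ) + 1) + 2 * α)) /
      ((2 * ((l : ℝ) + 1) + 2 * α + 1) * (2 * ((l : ℝ) + 1) + 2 * α - 1)))

/-- The associated ultraspherical polynomials: `pA α m l x = p_l^{(α)}(x, m)`.
For `m = 0` these are the orthonormal ultraspherical polynomials `p_l^{(α)}(x)`. -/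
def pA (α : ℝ) (m : ℕ) : ℕ → ℝ → ℝ
  | 0, _ => 1 / b α m
  | 1, x => x * (1 / b α m) / b α (m + 1)
  | l + 2, x => (x * pA α m (l + 1) x - b α (m + l + 1) * pA α m l x) / b α (m + l + 2)

/-- The orthonormal ultraspherical polynomials `p_l^{(α)}(x)`. -/
def p (α : ℝ) (l : ℕ) (x : ℝ) : ℝ := pA α 0 l x

/-- Ultraspherical polynomials with integer index; in particular `p_{-1}^{(α)} = 0`. -/
def pZ (α : ℝ) (l : ℤ) (x : ℝ) : ℝ := if 0 ≤ l then p α l.toNat x else 0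

/-- `JE α M i j` is the `(i,j)` entry (`0`-based) of the truncated Jacobi matrix
`J(α)_L^M` (of any size `L − M + 1`). -/
def JE (α : ℝ) (M : ℕ) (i j : ℕ) : ℝ :=
  if i + 1 = j then b α (M + i + 1) else if j + 1 = i then b α (M + j + 1) else 0

/-- The truncated Jacobi matrix `J(α)_{M+l}^M`, of size `(l+1) × (l+1)`.
In particular `Jt α 0 l` is the Jacobi matrix `J(α)_l`. -/
def Jt (α : ℝ) (M l : ℕ) : Matrix (Fin (l + 1)) (Fin (l + 1)) ℝ :=
  fun i j => JE α M i.1 j.1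

/-- The spherical harmonics `Y_l^k(θ, φ)`. -/
def Y (l : ℕ) (k : ℤ) (θ φ : ℝ) : ℂ :=
  ((Real.sin θ ^ k.natAbs : ℝ) : ℂ) * ((p (k.natAbs : ℝ) (l - k.natAbs) (Real.cos θ) : ℝ) : ℂ) *
    Complex.exp (Complex.I * (k : ℂ) * (φ : ℂ))

/-- Parameter region `[0, π] × [0, 2π]` of spherical coordinates. -/
def region : Set (ℝ × ℝ) := Set.Icc (0 : ℝ) Real.pi ×ˢ Set.Icc (0 : ℝ) (2 * Real.pi)

/-- The inner product of `L²(S²)`. -/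
def inner2 (f g : ℝ → ℝ → ℂ) : ℂ :=
  (1 / (4 * Real.pi)) *
    ∫ q in region, f q.1 q.2 * (starRingEnd ℂ) (g q.1 q.2) * ((Real.sin q.1 : ℝ) : ℂ)

/-- The norm of `L²(S²)`. -/
def norm2 (f : ℝ → ℝ → ℂ) : ℝ := Real.sqrt (inner2 f f).re

/-- Membership in `L²(S²)`. -/
def MemL2 (f : ℝ → ℝ → ℂ) : Prop :=
  Measurable (fun q : ℝ × ℝ => f q.1 q.2) ∧
    IntegrableOn (fun q : ℝ × ℝ => ‖f q.1 q.2‖ ^ 2 * Real.sin q.1) region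

/-- The multiplication operator `M`. -/
def Mop (f : ℝ → ℝ → ℂ) : ℝ → ℝ → ℂ := fun θ φ => ((Real.cos θ : ℝ) : ℂ) * f θ φ

/-- The power `M^j` of the multiplication operator. -/
def Mpow (j : ℕ) (f : ℝ → ℝ → ℂ) : ℝ → ℝ → ℂ := fun θ φ => ((Real.cos θ : ℝ) : ℂ) ^ j * f θ φ

/-- The mean value `ε(f)`. -/
def eps (f : ℝ → ℝ → ℂ) : ℝ :=
  (1 / (4 * Real.pi)) * ∫ q in region, Real.cos q.1 * ‖f q.1 q.2‖ ^ 2 * Real.sin q.1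

/-- The projection `P_n^m` onto `Π_n^m`. -/
def Pr (n m : ℕ) (f : ℝ → ℝ → ℂ) : ℝ → ℝ → ℂ :=
  fun θ φ => ∑ l ∈ Finset.Icc m n, ∑ k ∈ Finset.Icc (-(l : ℤ)) (l : ℤ),
    inner2 f (Y l k) * Y l k θ φ

/-- The space–frequency operator `P_n^m M P_n^m`. -/
def SFop (n m : ℕ) (f : ℝ → ℝ → ℂ) : ℝ → ℝ → ℂ := Pr n m (Mop (Pr n m f))

/-- The space `Π_n^m`, spanned by the spherical harmonics `Y_l^k`, `m ≤ l ≤ n`, `|k| ≤ l`. -/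
def Pi_nm (n m : ℕ) : Submodule ℂ (ℝ → ℝ → ℂ) :=
  Submodule.span ℂ {g | ∃ l : ℕ, ∃ k : ℤ, m ≤ l ∧ l ≤ n ∧ k.natAbs ≤ l ∧ g = Y l k}

/-- `N_k = n − max(|k|, m) + 1`. -/
def Nk (n m k : ℕ) : ℕ := n - max k m + 1

/-- The normalizing constant `κ_{k,i}`, given the corresponding root value `xr`. -/
def kap (n m k : ℕ) (xr : ℝ) : ℝ :=
  (Real.sqrt (∑ l ∈ Finset.Icc (max k m) n, (pA (k : ℝ) (m - k) (l - max k m) xr) ^ 2))⁻¹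

/-- The eigenfunction `ψ_{k,i}`, given the corresponding root value `xr`. -/
def psiFun (n m : ℕ) (k : ℤ) (xr : ℝ) : ℝ → ℝ → ℂ :=
  fun θ φ => ((kap n m k.natAbs xr : ℝ) : ℂ) *
    ∑ l ∈ Finset.Icc (max k.natAbs m) n,
      ((pA (k.natAbs : ℝ) (m - k.natAbs) (l - max k.natAbs m) xr : ℝ) : ℂ) * Y l k θ φ

open Polynomial in
/-- polynomial version of `p`. -/
def PP (α : ℝ) : ℕ → ℝ[X]
  | 0 => C (1 / b α 0)
  | 1 => C (1 / b α 1) * (X * C (1 / b α 0))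
  | l + 2 => C (1 / b α (l + 2)) * (X * PP α (l + 1) - C (b α (l + 1)) * PP α l)

lemma PP_eval (α : ℝ) (x : ℝ) (l : ℕ) : (PP α l).eval x = p α l x := by
  induction l using Nat.strong_induction_on with
  | _ l ih =>
    match l with
    | 0 => simp [PP, p, pA]
    | 1 => simp [PP, p, pA]; ring
    | l + 2 =>
      have h1 := ih l (by omega)
      have h2 := ih (l + 1) (by omega)
      simp only [p] at h1 h2
      simp [PP, p, pA, h1, h2]; ring

lemma b_pos (k : ℕ) (l : ℕ) : 0 < b (k : ℝ) l := by
  cases l with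
  | zero =>
    unfold b
    apply Real.sqrt_pos.2
    have := Real.Gamma_pos_of_pos (show (0 : ℝ) < k + 1 by positivity)
    have := Real.Gamma_pos_of_pos (show (0 : ℝ) < k + 3 / 2 by positivity)
    have := Real.pi_pos
    positivity
  | succ l =>
    unfold b
    apply Real.sqrt_pos.2
    have : (0 : ℝ) < 2 * ((l : ℝ) + 1) + 2 * k - 1 := by
      have : (0 : ℝ) ≤ l := by positivity
      have : (0 : ℝ) ≤ k := by positivity
      linarith
    positivity

lemma b_sq (k l : ℕ) : (2 * ((l : ℝ) + 1) + 2 * k + 1) * (2 * ((l : ℝ) + 1) + 2 * k - 1) *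
    (b (k : ℝ) (l + 1) ^ 2) = ((l : ℝ) + 1) * ((l : ℝ) + 1 + 2 * k) := by
  have : (0 : ℝ) < 2 * ((l : ℝ) + 1) + 2 * k - 1 := by
    have : (0 : ℝ) ≤ l := by positivity
    have : (0 : ℝ) ≤ k := by positivity
    linarith
  unfold b
  rw [Real.sq_sqrt (by positivity)]
  rw [mul_div_cancel₀]
  positivity

lemma b_zero_sq (k : ℕ) : (1 / 2 : ℝ) * ∫ θ in (0:ℝ)..Real.pi, Real.sin θ ^ (2 * k + 1) =
    b (k : ℝ) 0 ^ 2 := by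
  have hb : b (k : ℝ) 0 ^ 2 =
      Real.sqrt Real.pi * Real.Gamma (k + 1) / (2 * Real.Gamma (k + 3 / 2)) := by
    unfold b
    apply Real.sq_sqrt
    have := Real.Gamma_pos_of_pos (show (0 : ℝ) < k + 1 by positivity)
    have := Real.Gamma_pos_of_pos (show (0 : ℝ) < k + 3 / 2 by positivity)
    positivity
  rw [hb, integral_sin_pow_odd]
  clear hb
  induction k with
  | zero =>
    have h : Real.Gamma (3 / 2) = Real.sqrt Real.pi / 2 := by
      have := Real.Gamma_add_one (s := 1 / 2) (by norm_num)
      rw [Real.Gamma_one_half_eq] at this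
      norm_num at this
      rw [this]; ring
    have := Real.sqrt_pos.2 Real.pi_pos
    simp [h]
    field_simp
  | succ k ih =>
    rw [Finset.prod_range_succ]
    have h1 := Real.Gamma_add_one (s := (k : ℝ) + 1) (by positivity)
    have h2 := Real.Gamma_add_one (s := (k : ℝ) + 3 / 2) (by positivity)
    have e : ((k + 1 : ℕ) : ℝ) + 3 / 2 = (k : ℝ) + 3 / 2 + 1 := by push_cast; ring
    have := Real.Gamma_pos_of_pos (show (0 : ℝ) < k + 3 / 2 by positivity)
    rw [e, h2]
    push_cast
    rw [h1]
    rw [← mul_assoc, ← mul_assoc, mul_assoc (1 / 2 : ℝ) 2, ih]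
    field_simp

/-- `b` with `B 0 = 0`. -/
def B (k n : ℕ) : ℝ := if n = 0 then 0 else b k n

open Polynomial in
lemma PP_rec (k n : ℕ) : X * PP k n = C (b k (n + 1)) * PP k (n + 1) + C (B k n) * PP k (n - 1) := by
  have h := (b_pos k (n + 1)).ne'
  have hC : (C (b k (n + 1)) : ℝ[X]) * C (1 / b k (n + 1)) = 1 := by
    rw [← C_mul, mul_one_div_cancel h, C_1]
  cases n with
  | zero =>
    simp only [PP, B, zero_add] at hC ⊢
    rw [← mul_assoc, hC]; simp
  | succ n =>
    simp only [PP, B]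
    rw [← mul_assoc, hC]; simp

lemma b_key (k n : ℕ) : 1 + (2 * (n : ℝ) + 2 * k + 1) * b k (n + 1) ^ 2 =
    (2 * n + 2 * k + 5) * b k (n + 2) ^ 2 := by
  have h1 := b_sq k n
  have h2 := b_sq k (n + 1)
  push_cast at h2
  have h : (2 * (n : ℝ) + 2 * k + 3) ≠ 0 := by positivity
  apply mul_left_cancel₀ h
  linear_combination h1 - h2

lemma b_key0 (k : ℕ) : (2 * (k : ℝ) + 3) * b k 1 ^ 2 = 1 := by
  have h1 := b_sq k 0
  push_cast at h1
  have h : (2 * (k : ℝ) + 1) ≠ 0 := by positivity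
  apply mul_left_cancel₀ h
  linear_combination h1

open Polynomial in
lemma PP_d2 (k n : ℕ) (h : (1 - X ^ 2) * derivative (PP k n) =
    - C (n : ℝ) * X * PP k n + C ((2 * n + 2 * k + 1) * B k n) * PP k (n - 1)) :
    (1 - X ^ 2) * derivative (PP k n) = (C (n : ℝ) + 1 + 2 * C (k : ℝ)) * X * PP k n -
      (2 * C (n : ℝ) + 2 * C (k : ℝ) + 1) * C (b k (n + 1)) * PP k (n + 1) := by
  have hr := PP_rec k n
  simp only [map_add, map_mul, map_ofNat, map_one] at h
  linear_combination h - (2 * C (n : ℝ) + 2 * C (k : ℝ) + 1) * hr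

open Polynomial in
lemma PP_d1 (k n : ℕ) : (1 - X ^ 2) * derivative (PP k n) =
    - C (n : ℝ) * X * PP k n + C ((2 * n + 2 * k + 1) * B k n) * PP k (n - 1) := by
  induction n using Nat.strong_induction_on with
  | _ n ih =>
    match n with
    | 0 => simp [PP, B]
    | n + 1 =>
      have hb := (b_pos k (n + 1)).ne'
      have h := ih n (by omega)
      have hr := PP_rec k n
      have hd := congrArg derivative hr
      simp only [derivative_mul, derivative_add, derivative_X, derivative_C] at hd
      apply mul_left_cancel₀ (C_ne_zero.2 hb)
      match n with
      | 0 =>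
        have hs := congrArg (C : ℝ → ℝ[X]) (b_key0 k)
        have hp : derivative (PP k 0) = 0 := by simp [PP]
        simp only [B, map_add, map_mul, map_ofNat, map_one, map_pow, hp, zero_add, Nat.cast_one,
          if_true, map_zero, zero_mul, mul_zero, add_zero, one_ne_zero, if_false, Nat.sub_self,
          Nat.cast_zero, mul_one, one_mul] at *
        linear_combination -(1 - X ^ 2) * hd - X * hr - hs * PP k 0
      | n + 1 =>
        have h' := PP_d2 k n (ih n (by omega))
        have hs := congrArg (C : ℝ → ℝ[X]) (b_key k n)
        simp only [B, map_add, map_mul, map_ofNat, map_one, map_pow, Nat.cast_add, Nat.cast_one,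
          Nat.add_sub_cancel, Nat.succ_ne_zero, if_false, zero_mul, zero_add] at *
        linear_combination -(1 - X ^ 2) * hd + X * h - C (b k (n + 1)) * h' -
          (C (n : ℝ) + 2) * X * hr + hs * PP k (n + 1)

open Polynomial in
lemma PP_ode (k n : ℕ) : (1 - X ^ 2) * derivative (derivative (PP k n)) -
    2 * (C (k : ℝ) + 1) * X * derivative (PP k n) = - C ((n : ℝ) * (n + 2 * k + 1)) * PP k n := by
  match n with
  | 0 => simp [PP]
  | n + 1 =>
    have hx : (1 - X ^ 2 : ℝ[X]) ≠ 0 := by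
      intro h
      have := congrArg (fun q => q.eval 0) h
      simp at this
    have h1 := PP_d1 k (n + 1)
    have h0 := PP_d2 k n (PP_d1 k n)
    have hs := congrArg (C : ℝ → ℝ[X]) (b_sq k n)
    have hd := congrArg derivative h1
    apply mul_left_cancel₀ hx
    simp only [B, map_add, map_sub, map_mul, map_ofNat, map_one, map_pow, Nat.cast_add, Nat.cast_one,
          Nat.add_sub_cancel, Nat.succ_ne_zero, if_false, zero_mul, zero_add] at *
    simp only [derivative_mul, derivative_add, derivative_sub, derivative_neg, derivative_X,
      derivative_C, derivative_one, derivative_ofNat, derivative_X_pow, Nat.cast_ofNat, map_ofNat] at hd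
    linear_combination (1 - X ^ 2) * hd
      - (C (n : ℝ) + 1 + 2 * C (k : ℝ)) * X * h1
      + (2 * (C (n : ℝ) + 1) + 2 * C (k : ℝ) + 1) * C (b k (n + 1)) * h0
      - PP k (n + 1) * hs

/-- the functional -/
def L (k : ℕ) (f : Polynomial ℝ) : ℝ :=
  (1 / 2) * ∫ θ in (0:ℝ)..Real.pi, f.eval (Real.cos θ) * Real.sin θ ^ (2 * k + 1)

lemma L_int (k : ℕ) (f : Polynomial ℝ) : IntervalIntegrable
    (fun θ => f.eval (Real.cos θ) * Real.sin θ ^ (2 * k + 1)) volume 0 Real.pi := by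
  apply Continuous.intervalIntegrable
  have := f.continuous
  fun_prop

lemma L_add (k : ℕ) (f g : Polynomial ℝ) : L k (f + g) = L k f + L k g := by
  unfold L
  rw [← mul_add, ← intervalIntegral.integral_add (L_int k f) (L_int k g)]
  simp [add_mul]

lemma L_C (k : ℕ) (a : ℝ) (f : Polynomial ℝ) : L k (Polynomial.C a * f) = a * L k f := by
  unfold L
  simp only [Polynomial.eval_mul, Polynomial.eval_C, mul_assoc, intervalIntegral.integral_const_mul]
  ring

lemma L_PP_zero (k : ℕ) : L k (PP k 0) = b k 0 := by
  have h := (b_pos k 0).ne'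
  have h2 : L k (Polynomial.C (1 / b k 0) * 1) = b k 0 := by
    rw [L_C]
    unfold L
    simp only [Polynomial.eval_one, one_mul]
    rw [b_zero_sq]
    field_simp
  rw [mul_one] at h2
  simpa only [PP] using h2

lemma L_PP (k n : ℕ) (hn : n ≠ 0) : L k (PP k n) = 0 := by
  have h : ((n : ℝ) * (n + 2 * k + 1)) * ∫ θ in (0:ℝ)..Real.pi,
      (PP k n).eval (Real.cos θ) * Real.sin θ ^ (2 * k + 1) = 0 := by
    rw [← intervalIntegral.integral_const_mul]
    rw [intervalIntegral.integral_eq_sub_of_hasDerivAt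
      (f := fun θ => Real.sin θ ^ (2 * k + 2) * (Polynomial.derivative (PP k n)).eval (Real.cos θ))]
    · simp
    · intro θ _
      have hd := ((Real.hasDerivAt_sin θ).pow (2 * k + 2)).mul
        (((Polynomial.derivative (PP k n)).hasDerivAt (Real.cos θ)).comp θ (Real.hasDerivAt_cos θ))
      refine HasDerivAt.congr_deriv hd (Eq.symm ?_)
      have ho := congrArg (fun q => q.eval (Real.cos θ)) (PP_ode k n)
      simp at ho
      have hsc := Real.sin_sq_add_cos_sq θ
      have e : (1 - Real.cos θ ^ 2) = Real.sin θ ^ 2 := by linarith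
      rw [e] at ho
      have : (n : ℝ) * (n + 2 * k + 1) * (PP k n).eval (Real.cos θ) =
        2 * (k + 1) * Real.cos θ * (Polynomial.derivative (PP k n)).eval (Real.cos θ) -
        Real.sin θ ^ 2 * (Polynomial.derivative (Polynomial.derivative (PP k n))).eval (Real.cos θ) := by
        linarith
      rw [← mul_assoc, this]
      simp
      ring
    · apply (L_int k (PP k n)).const_mul
  unfold L
  have h0 : ((n : ℝ) * (n + 2 * k + 1)) ≠ 0 := by positivity
  rw [(mul_eq_zero.1 h).resolve_left h0, mul_zero]

open Polynomial in
lemma L_X (k n m : ℕ) : L k (X * (PP k n * PP k m)) =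
    b k (n + 1) * L k (PP k (n + 1) * PP k m) + B k n * L k (PP k (n - 1) * PP k m) := by
  rw [← mul_assoc, PP_rec, add_mul, L_add, mul_assoc, mul_assoc, L_C, L_C]

lemma L_orth (k m n : ℕ) : L k (PP k n * PP k m) = if n = m then 1 else 0 := by
  induction m using Nat.strong_induction_on generalizing n with
  | _ m ih =>
    match m with
    | 0 =>
      have h := (b_pos k 0).ne'
      have e : PP k n * PP k 0 = Polynomial.C (1 / b k 0) * PP k n := by
        simp only [PP]; ring
      rw [e, L_C]
      split_ifs with hn
      · subst hn; rw [L_PP_zero]; field_simp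
      · rw [L_PP k n hn, mul_zero]
    | m + 1 =>
      have h := (b_pos k (m + 1)).ne'
      have h1 := L_X k n m
      have h2 := L_X k m n
      rw [mul_comm (PP k m), h1, ih m (by omega), ih m (by omega), mul_comm _ (PP k n),
        mul_comm _ (PP k n)] at h2
      apply mul_left_cancel₀ h
      by_cases hm : m = 0
      · subst hm
        simp only [B] at h2
        rcases n with _ | _ | n <;> simp_all
      · rw [ih (m - 1) (by omega)] at h2
        obtain ⟨m, rfl⟩ := Nat.exists_eq_succ_of_ne_zero hm
        simp only [B] at h2
        rcases n with _ | n
        · simp at h2 ⊢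
          grind
        · simp at h2 ⊢
          grind

lemma L_JE (k M i j : ℕ) : L k (Polynomial.X * (PP k (M + i) * PP k (M + j))) = JE k M i j := by
  rw [L_X, L_orth, L_orth]
  unfold JE B
  grind

lemma term_int (k n m : ℕ) (c : ℕ → ℂ) (hmn : m ≤ n) (hk : k ≤ m) :
    ((((1 : ℝ) / 2) * ∫ θ in (0:ℝ)..Real.pi, Real.cos θ *
        ‖∑ l ∈ Finset.Icc m n,
            c l * ((p (k : ℝ) (l - k) (Real.cos θ) : ℝ) : ℂ)‖ ^ 2 *
          Real.sin θ ^ (2 * k + 1) : ℝ) : ℂ) =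
      ∑ i ∈ Finset.range (n - m + 1), ∑ j ∈ Finset.range (n - m + 1),
        (starRingEnd ℂ) (c (m + i)) * ((JE (k : ℝ) (m - k) i j : ℝ) : ℂ) *
          c (m + j) := by
  have hre : ∀ f : ℕ → ℂ, ∑ l ∈ Finset.Icc m n, f l = ∑ i ∈ Finset.range (n - m + 1), f (m + i) := by
    intro f
    rw [← Finset.Ico_add_one_right_eq_Icc, Finset.sum_Ico_eq_sum_range]
    congr 2; omega
  have hpt : ∀ θ : ℝ, ((Real.cos θ *
        ‖∑ l ∈ Finset.Icc m n,
            c l * ((p (k : ℝ) (l - k) (Real.cos θ) : ℝ) : ℂ)‖ ^ 2 *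
          Real.sin θ ^ (2 * k + 1) : ℝ) : ℂ) =
      ∑ i ∈ Finset.range (n - m + 1), ∑ j ∈ Finset.range (n - m + 1),
        (starRingEnd ℂ) (c (m + i)) * c (m + j) *
        (((Polynomial.X * (PP k (m - k + i) * PP k (m - k + j))).eval (Real.cos θ) *
          Real.sin θ ^ (2 * k + 1) : ℝ) : ℂ) := by
    intro θ
    rw [Complex.ofReal_mul, Complex.ofReal_mul, Complex.ofReal_pow, ← Complex.conj_mul', hre, map_sum,
      Finset.sum_mul_sum, Finset.mul_sum, Finset.sum_mul]
    refine Finset.sum_congr rfl fun i _ => ?_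
    rw [Finset.mul_sum, Finset.sum_mul]
    refine Finset.sum_congr rfl fun j _ => ?_
    have e1 : m - k + i = m + i - k := by omega
    have e2 : m - k + j = m + j - k := by omega
    simp only [Polynomial.eval_mul, Polynomial.eval_X, PP_eval, map_mul, Complex.conj_ofReal, e1, e2,
      Complex.ofReal_mul]
    ring
  rw [Complex.ofReal_mul, ← intervalIntegral.integral_ofReal]
  simp only [hpt]
  have hi : ∀ i j : ℕ, IntervalIntegrable (fun θ : ℝ => (starRingEnd ℂ) (c (m + i)) * c (m + j) *
        (((Polynomial.X * (PP k (m - k + i) * PP k (m - k + j))).eval (Real.cos θ) *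
          Real.sin θ ^ (2 * k + 1) : ℝ) : ℂ)) volume 0 Real.pi := by
    intro i j
    apply Continuous.intervalIntegrable
    have := (Polynomial.X * (PP k (m - k + i) * PP k (m - k + j))).continuous
    fun_prop
  rw [intervalIntegral.integral_finsetSum, Finset.mul_sum]
  · refine Finset.sum_congr rfl fun i _ => ?_
    rw [intervalIntegral.integral_finsetSum, Finset.mul_sum]
    · refine Finset.sum_congr rfl fun j _ => ?_
      rw [intervalIntegral.integral_const_mul, intervalIntegral.integral_ofReal, ← L_JE, L,
        Complex.ofReal_mul]
      ring
    · intro j _; exact hi i j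
  · intro i _
    have := IntervalIntegrable.sum (Finset.range (n - m + 1)) (fun j _ => hi i j)
    simpa only [Finset.sum_fn] using this

lemma eps_eq (n m : ℕ) (k : ℤ) (c : ℕ → ℂ) :
    eps (fun θ φ => ∑ l ∈ Finset.Icc m n, c l * Y l k θ φ) =
    (((1 : ℝ) / 2) * ∫ θ in (0:ℝ)..Real.pi, Real.cos θ *
        ‖∑ l ∈ Finset.Icc m n,
            c l * ((p (k.natAbs : ℝ) (l - k.natAbs) (Real.cos θ) : ℝ) : ℂ)‖ ^ 2 *
          Real.sin θ ^ (2 * k.natAbs + 1) : ℝ) := by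
  have hpt : ∀ q : ℝ × ℝ, Real.cos q.1 * ‖∑ l ∈ Finset.Icc m n, c l * Y l k q.1 q.2‖ ^ 2 *
      Real.sin q.1 = (Real.cos q.1 *
        ‖∑ l ∈ Finset.Icc m n,
            c l * ((p (k.natAbs : ℝ) (l - k.natAbs) (Real.cos q.1) : ℝ) : ℂ)‖ ^ 2 *
          Real.sin q.1 ^ (2 * k.natAbs + 1)) * (fun _ : ℝ => (1 : ℝ)) q.2 := by
    intro q
    have e : ∑ l ∈ Finset.Icc m n, c l * Y l k q.1 q.2 =
      ((Real.sin q.1 ^ k.natAbs : ℝ) : ℂ) * Complex.exp ((((k : ℝ) * q.2 : ℝ) : ℂ) * Complex.I) *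
      ∑ l ∈ Finset.Icc m n,
            c l * ((p (k.natAbs : ℝ) (l - k.natAbs) (Real.cos q.1) : ℝ) : ℂ) := by
      rw [Finset.mul_sum]
      refine Finset.sum_congr rfl fun l _ => ?_
      unfold Y
      have : Complex.I * (k : ℂ) * (q.2 : ℂ) = (((k : ℝ) * q.2 : ℝ) : ℂ) * Complex.I := by
        push_cast; ring
      rw [this]
      ring
    rw [e, norm_mul, norm_mul, Complex.norm_exp_ofReal_mul_I, Complex.norm_real, mul_pow, mul_one,
      Real.norm_eq_abs, sq_abs]
    ring
  unfold eps region
  simp only [hpt]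
  rw [Measure.volume_eq_prod, setIntegral_prod_mul (f := fun θ : ℝ => (Real.cos θ *
        ‖∑ l ∈ Finset.Icc m n,
            c l * ((p (k.natAbs : ℝ) (l - k.natAbs) (Real.cos θ) : ℝ) : ℂ)‖ ^ 2 *
          Real.sin θ ^ (2 * k.natAbs + 1))) (g := fun _ => (1 : ℝ)),
    intervalIntegral.integral_of_le Real.pi_pos.le, integral_Icc_eq_integral_Ioc]
  have : (∫ _ in Set.Icc (0:ℝ) (2 * Real.pi), (1 : ℝ)) = 2 * Real.pi := by
    simp [Real.pi_pos.le]
  rw [this]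
  have := Real.pi_pos
  field_simp
  ring

/-- for `−m ≤ k ≤ m`, the quadratic-form identity
`(1/2)∫₀^π cosθ |Σ_{l=m}^n c_l p_{l−|k|}^{(|k|)}(cosθ)|² sin^{2|k|+1}θ dθ
  = c^H J(|k|)_{n−|k|}^{m−|k|} c`, and equivalently `ε(Σ_{l=m}^n c_l Y_l^k)` equals the
same quadratic form. -/
theorem stmt4 (n m : ℕ) (hmn : m ≤ n) (k : ℤ) (hk : k.natAbs ≤ m) (c : ℕ → ℂ) :
    ((((1 : ℝ) / 2) * ∫ θ in (0:ℝ)..Real.pi, Real.cos θ *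
        ‖∑ l ∈ Finset.Icc m n,
            c l * ((p (k.natAbs : ℝ) (l - k.natAbs) (Real.cos θ) : ℝ) : ℂ)‖ ^ 2 *
          Real.sin θ ^ (2 * k.natAbs + 1) : ℝ) : ℂ) =
      ∑ i ∈ Finset.range (n - m + 1), ∑ j ∈ Finset.range (n - m + 1),
        (starRingEnd ℂ) (c (m + i)) * ((JE (k.natAbs : ℝ) (m - k.natAbs) i j : ℝ) : ℂ) *
          c (m + j) ∧
    ((eps (fun θ φ => ∑ l ∈ Finset.Icc m n, c l * Y l k θ φ) : ℝ) : ℂ) =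
      ∑ i ∈ Finset.range (n - m + 1), ∑ j ∈ Finset.range (n - m + 1),
        (starRingEnd ℂ) (c (m + i)) * ((JE (k.natAbs : ℝ) (m - k.natAbs) i j : ℝ) : ℂ) *
          c (m + j) := by
  refine ⟨term_int _ n m c hmn hk, ?_⟩
  rw [eps_eq]
  exact term_int _ n m c hmn hk
end SFT
end
end

section
/- Let 0 ≤ m ≤ n and −m ≤ k ≤ m be integers. For each 1 ≤ i ≤ n−m+1, the function ψ_{k,i} belongs to Π_n^m, has unit norm, and is an eigenfunction of the space-frequency operator: P_n^m M P_n^m ψ_{k,i} = x_{|k|,i} ψ_{k,i}. Moreover, for all (θ,φ) with cosθ ≠ x_{|k|,i}, ψ_{k,i}(θ,φ) = κ_{k,i} · sin^{|k|}θ · e^{ikφ} · [b_{n−|k|+1}^{(|k|)} p_{n−m}^{(|k|)}(x_{|k|,i}, m−|k|) · p_{n−|k|+1}^{(|k|)}(cosθ) + p_{m−|k|−1}^{(|k|)}(cosθ)] / (cosθ − x_{|k|,i}). -/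
open MeasureTheory Finset

noncomputable section

namespace SFT

lemma bsq (α : ℝ) (hα : 0 ≤ α) (l : ℕ) : (b α (l+1))^2 = (((l : ℝ) + 1) * (((l : ℝ) + 1) + 2 * α)) /
      ((2 * ((l : ℝ) + 1) + 2 * α + 1) * (2 * ((l : ℝ) + 1) + 2 * α - 1)) := by
  have hl : (0:ℝ) ≤ l := Nat.cast_nonneg l
  have h2 : 0 < 2 * ((l : ℝ) + 1) + 2 * α - 1 := by linarith
  rw [b, Real.sq_sqrt]
  positivity

lemma bsq' (α : ℝ) (hα : 0 ≤ α) (l : ℕ) : (b α (l+1))^2 = (((l : ℝ) + 1) * ((l : ℝ) + 1 + 2 * α)) /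
      ((2 * l + 2 * α + 3) * (2 * l + 2 * α + 1)) := by
  rw [bsq α hα]; congr 1; ring

lemma b0sq (α : ℝ) (hα : 0 ≤ α) : (b α 0)^2 =
    Real.sqrt Real.pi * Real.Gamma (α + 1) / (2 * Real.Gamma (α + 3 / 2)) := by
  have h1 : 0 < Real.Gamma (α + 1) := Real.Gamma_pos_of_pos (by linarith)
  have h2 : 0 < Real.Gamma (α + 3/2) := Real.Gamma_pos_of_pos (by linarith)
  rw [b, Real.sq_sqrt]
  positivity

lemma bpos (α : ℝ) (hα : 0 ≤ α) (l : ℕ) : 0 < b α l := by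
  cases l with
  | zero =>
    have h1 : 0 < Real.Gamma (α + 1) := Real.Gamma_pos_of_pos (by linarith)
    have h2 : 0 < Real.Gamma (α + 3/2) := Real.Gamma_pos_of_pos (by linarith)
    have h3 := Real.pi_pos
    rw [b]
    positivity
  | succ l =>
    have hl : (0:ℝ) ≤ l := Nat.cast_nonneg l
    have h2 : 0 < 2 * ((l : ℝ) + 1) + 2 * α - 1 := by linarith
    rw [b]
    positivity

/-- shifted-down associated polynomial, zero at index zero -/
def rA (α : ℝ) (m : ℕ) : ℕ → ℝ → ℝ
  | 0, _ => 0
  | l + 1, x => pA α m l x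

lemma pA_rec (α : ℝ) (hα : 0 ≤ α) (m l : ℕ) (x : ℝ) :
    b α (m + l + 1) * pA α m (l+1) x = x * pA α m l x - b α (m + l) * rA α m l x := by
  have h := (bpos α hα (m+l+1)).ne'
  cases l with
  | zero => simp only [pA, rA]; simp only [Nat.add_zero] at h ⊢; field_simp; ring
  | succ l => simp only [pA, rA]; rw [show m + (l+1) + 1 = m + l + 2 by ring] at *; rw [show m + (l+1) = m + l + 1 by ring]; field_simp

lemma p_rec (α : ℝ) (hα : 0 ≤ α) (l : ℕ) (x : ℝ) :
    b α (l + 1) * p α (l+1) x = x * p α l x - b α l * rA α 0 l x := by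
  have := pA_rec α hα 0 l x
  simp only [Nat.zero_add] at this
  exact this

/-- Christoffel-Darboux type identity. -/
lemma CD (α : ℝ) (hα : 0 ≤ α) (M L : ℕ) (x y : ℝ) :
    (y - x) * ∑ l ∈ range (L+1), pA α M l x * p α (M + l) y =
      b α (M+L+1) * (pA α M L x * p α (M+L+1) y - pA α M (L+1) x * p α (M+L) y) + rA α 0 M y := by
  have hb := (bpos α hα M).ne'
  induction L with
  | zero =>
    have h1 := p_rec α hα M y
    have h2 := pA_rec α hα M 0 x
    rw [show rA α M 0 x = 0 from rfl] at h2
    simp only [Nat.add_zero] at h1 h2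
    have h3 : b α M * pA α M 0 x = 1 := by simp only [pA]; field_simp
    simp only [Nat.zero_add, sum_range_one, Nat.add_zero]
    linear_combination (-pA α M 0 x) * h1 + p α M y * h2 + (rA α 0 M y) * h3
  | succ L ih =>
    rw [sum_range_succ, mul_add, ih]
    have h1 := p_rec α hα (M + (L+1)) y
    have h2 := pA_rec α hα M (L+1) x
    rw [show rA α 0 (M+(L+1)) y = p α (M+L) y from rfl] at h1
    rw [show rA α M (L+1) x = pA α M L x from rfl] at h2
    simp only [← Nat.add_assoc] at h1 h2 ⊢
    linear_combination (-pA α M (L+1) x) * h1 + p α (M+L+1) y * h2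

lemma pA_diff (α : ℝ) (m l : ℕ) : Differentiable ℝ (pA α m l) := by
  induction l using Nat.twoStepInduction with
  | zero => 
    have : pA α m 0 = fun _ => 1 / b α m := by funext x; rw [pA]
    rw [this]; fun_prop
  | one =>
    have : pA α m 1 = fun x => x * (1 / b α m) / b α (m + 1) := by funext x; rw [pA]
    rw [this]; fun_prop
  | more l h1 h2 =>
    have : pA α m (l+2) = fun x => (x * pA α m (l + 1) x - b α (m + l + 1) * pA α m l x) / b α (m + l + 2) := by
      funext x; rw [pA]
    rw [this]; fun_prop

lemma p_diff (α : ℝ) (l : ℕ) : Differentiable ℝ (p α l) := pA_diff α 0 l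

lemma structA (α : ℝ) (hα : 0 ≤ α) (j : ℕ) (x : ℝ) :
    (1 - x^2) * deriv (p α j) x = - j * x * p α j x + (2 * j + 2 * α + 1) * b α j * rA α 0 j x := by
  induction j using Nat.twoStepInduction with
  | zero =>
    have : p α 0 = fun _ => 1 / b α 0 := by funext x; rfl
    rw [this]; simp [rA]
  | one =>
    have : p α 1 = fun x => x * (1 / b α 0 / b α 1) := by
      funext x; simp only [p, pA, Nat.zero_add]; ring
    rw [this]
    have h0 := (bpos α hα 0).ne'
    have h1 := (bpos α hα 1).ne'
    have h2 := bsq' α hα 0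
    have h3 : (2 * α + 3) * b α 1 ^ 2 = 1 := by
      rw [show b α 1 = b α (0+1) from rfl, h2]; simp only [Nat.cast_zero]
      field_simp; ring
    simp only [deriv_mul_const_field, deriv_id'', rA, pA]
    push_cast
    field_simp
    linear_combination (-1) * h3
  | more j ih1 ih2 =>
    have hb := (bpos α hα (j+2)).ne'
    have e : p α (j+2) = fun x => (x * p α (j+1) x - b α (j+1) * p α j x) / b α (j+2) := by
      funext x; simp only [p, pA, Nat.zero_add]
    have hd : deriv (p α (j+2)) x =
        (p α (j+1) x + x * deriv (p α (j+1)) x - b α (j+1) * deriv (p α j) x) / b α (j+2) := by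
      rw [e]
      have d1 := (p_diff α (j+1) x).hasDerivAt
      have d2 := (p_diff α j x).hasDerivAt
      have := (((hasDerivAt_id x).mul d1).sub (d2.const_mul (b α (j+1)))).div_const (b α (j+2))
      simpa using this.deriv
    have r1 := p_rec α hα j x
    have r2 := p_rec α hα (j+1) x
    have hd' : b α (j+2) * deriv (p α (j+2)) x =
        (p α (j+1) x + x * deriv (p α (j+1)) x - b α (j+1) * deriv (p α j) x) := by
      rw [hd]; field_simp
    have hkey : 1 + (2 * j + 2 * α + 1) * b α (j+1)^2 = (2 * j + 2 * α + 5) * b α (j+2)^2 := by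
      rw [bsq' α hα j, bsq' α hα (j+1)]
      push_cast
      rw [show 2 * ((j:ℝ)+1) + 2 * α + 3 = 2 * j + 2 * α + 5 by ring, show 2 * ((j:ℝ)+1) + 2 * α + 1 = 2 * j + 2 * α + 3 by ring]
      field_simp
      ring
    simp only [rA] at r2 ih2 ⊢
    simp only [show ∀ i, pA α 0 i x = p α i x from fun _ => rfl] at *
    apply mul_left_cancel₀ hb
    push_cast at *
    simp only [show j + 1 + 1 = j + 2 from rfl] at *
    linear_combination (1 - x^2) * hd' + x * ih2 - b α (j+1) * ih1 - (2*j+2*α+1) * b α (j+1) * r1 + p α (j+1) x * hkey + ((j:ℝ)+2) * x * r2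

/-- the weighted integral -/
def Lw (a : ℕ) (f : ℝ → ℝ) : ℝ := ∫ θ in (0:ℝ)..Real.pi, Real.sin θ ^ (2*a+1) * f (Real.cos θ)

lemma Lw_int (a : ℕ) (f : ℝ → ℝ) (hf : Continuous f) :
    IntervalIntegrable (fun θ => Real.sin θ ^ (2*a+1) * f (Real.cos θ)) volume 0 Real.pi := by
  apply Continuous.intervalIntegrable; fun_prop

lemma Lw_add (a : ℕ) (f g : ℝ → ℝ) (hf : Continuous f) (hg : Continuous g) :
    Lw a (fun x => f x + g x) = Lw a f + Lw a g := by
  unfold Lw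
  rw [← intervalIntegral.integral_add (Lw_int a f hf) (Lw_int a g hg)]
  congr 1; funext θ; ring

lemma Lw_smul (a : ℕ) (c : ℝ) (f : ℝ → ℝ) :
    Lw a (fun x => c * f x) = c * Lw a f := by
  unfold Lw
  rw [← intervalIntegral.integral_const_mul]
  congr 1; funext θ; ring

lemma p_cont (α : ℝ) (l : ℕ) : Continuous (p α l) := (p_diff α l).continuous

lemma rA_cont (α : ℝ) (l : ℕ) : Continuous (rA α 0 l) := by
  cases l with
  | zero => unfold rA; fun_prop
  | succ l => exact p_cont α l

lemma Lw_one (a : ℕ) : Lw a (fun _ => 1) = 2 * (b a 0)^2 := by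
  have ha : (0:ℝ) ≤ a := Nat.cast_nonneg a
  rw [b0sq _ ha]
  unfold Lw
  simp only [mul_one]
  induction a with
  | zero =>
    have : Real.Gamma (3/2) = Real.sqrt Real.pi / 2 := by
      rw [show (3/2:ℝ) = 1/2 + 1 by norm_num, Real.Gamma_add_one (by norm_num), Real.Gamma_one_half_eq]
      ring
    have hp : Real.sqrt Real.pi ≠ 0 := by have := Real.pi_pos; positivity
    simp [this]
    field_simp
    norm_num
  | succ a ih =>
    have ha' : (0:ℝ) ≤ a := Nat.cast_nonneg a
    rw [show 2 * (a+1) + 1 = (2*a+1) + 2 by ring, integral_sin_pow, ih ha']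
    have g1 : Real.Gamma (((a+1:ℕ):ℝ) + 1) = (a+1) * Real.Gamma (a+1) := by
      push_cast; rw [Real.Gamma_add_one (by positivity)]
    have g2 : Real.Gamma (((a+1:ℕ):ℝ) + 3/2) = (a+3/2) * Real.Gamma (a+3/2) := by
      rw [← Real.Gamma_add_one (by positivity)]; push_cast; congr 1; ring
    have h2 : Real.Gamma ((a:ℝ) + 3/2) ≠ 0 := (Real.Gamma_pos_of_pos (by linarith)).ne'
    rw [g1, g2]
    simp
    field_simp
    ring

lemma Lw_ibp (a j : ℕ) : (j + 2 * a + 2) * Lw a (fun x => x * p a j x) =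
    (2 * j + 2 * a + 1) * b a j * Lw a (rA a 0 j) := by
  have ha : (0:ℝ) ≤ a := Nat.cast_nonneg a
  have hpc := p_cont a j
  have hrc := rA_cont a j
  have key : Lw a (fun x => (j + 2 * a + 2) * (x * p a j x) + (-((2 * j + 2 * a + 1) * b a j)) * rA a 0 j x) = 0 := by
    unfold Lw
    have hd : ∀ θ ∈ Set.uIcc 0 Real.pi, HasDerivAt (fun θ => Real.sin θ ^ (2*a+2) * p a j (Real.cos θ))
      (Real.sin θ ^ (2*a+1) * ((j + 2 * a + 2) * (Real.cos θ * p a j (Real.cos θ)) + (-((2 * j + 2 * a + 1) * b a j)) * rA a 0 j (Real.cos θ))) θ := by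
      intro θ _
      have h1 := (Real.hasDerivAt_sin θ).pow (2*a+2)
      have h2 := (p_diff a j (Real.cos θ)).hasDerivAt.comp θ (Real.hasDerivAt_cos θ)
      have h3 := h1.mul h2
      refine h3.congr_deriv ?_
      have hs := structA a ha j (Real.cos θ)
      have hsc : 1 - Real.cos θ ^ 2 = Real.sin θ ^ 2 := by rw [Real.sin_sq]
      rw [hsc] at hs
      simp only [Function.comp, Pi.pow_apply, show 2*a+2-1 = 2*a+1 from rfl]
      push_cast
      linear_combination (-Real.sin θ ^ (2*a+1)) * hs
    rw [intervalIntegral.integral_eq_sub_of_hasDerivAt hd]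
    · simp
    · apply Continuous.intervalIntegrable; fun_prop
  rw [Lw_add _ _ _ (by fun_prop) (by fun_prop), Lw_smul, Lw_smul] at key
  linarith

lemma Lw_rec (a j : ℕ) : Lw a (fun x => x * p a j x) = b a (j+1) * Lw a (p a (j+1)) + b a j * Lw a (rA a 0 j) := by
  have hpc := p_cont a (j+1)
  have hrc := rA_cont a j
  rw [← Lw_smul, ← Lw_smul, ← Lw_add _ _ _ (by fun_prop) (by fun_prop)]
  congr 1; funext x
  have := p_rec a (Nat.cast_nonneg a) j x
  linarith

lemma Lw_p (a j : ℕ) : Lw a (p a (j+1)) = 0 := by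
  have H : ∀ j : ℕ, ((j:ℝ) + 2*a+2) * b a (j+1) * Lw a (p a (j+1)) = (j - 1) * b a j * Lw a (rA a 0 j) := by
    intro j
    have h1 := Lw_ibp a j
    rw [Lw_rec] at h1
    linarith
  have hne : ∀ j : ℕ, ((j:ℝ) + 2*a+2) * b a (j+1) ≠ 0 := by
    intro j
    have := bpos a (Nat.cast_nonneg a) (j+1)
    positivity
  induction j using Nat.twoStepInduction with
  | zero =>
    have h := H 0
    have h0 : Lw a (rA a 0 0) = 0 := by unfold Lw rA; simp
    rw [h0, mul_zero] at h
    exact (mul_eq_zero.mp h).resolve_left (hne 0)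
  | one =>
    have h := H 1
    simp only [Nat.cast_one, sub_self, zero_mul] at h
    refine (mul_eq_zero.mp h).resolve_left ?_
    have := hne 1
    simpa using this
  | more j ih1 ih2 =>
    have h := H (j+2)
    rw [show rA a 0 (j+2) = p a (j+1) from rfl, ih1, mul_zero] at h
    exact (mul_eq_zero.mp h).resolve_left (hne (j+2))

/-- Gram matrix -/
def G (a i j : ℕ) : ℝ := Lw a (fun x => p a i x * p a j x)

lemma p_zero (α x : ℝ) : p α 0 x = 1 / b α 0 := rfl

lemma G_zero (a j : ℕ) : G a 0 j = if 0 = j then 2 else 0 := by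
  have hb := (bpos a (Nat.cast_nonneg a) 0).ne'
  unfold G
  simp only [p_zero]
  rw [Lw_smul]
  cases j with
  | zero =>
    have : p (a:ℝ) 0 = fun x => 1 / b a 0 * 1 := by funext x; simp [p_zero]
    rw [this, Lw_smul, Lw_one]
    simp; field_simp
  | succ j => rw [Lw_p]; simp

lemma G_rec (a i j : ℕ) : b a (i+1) * G a (i+1) j + b a i * Lw a (fun x => rA a 0 i x * p a j x)
   = b a (j+1) * G a i (j+1) + b a j * Lw a (fun x => p a i x * rA a 0 j x) := by
  have h1 := p_cont a (i+1)
  have h2 := rA_cont a i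
  have h3 := p_cont a (j+1)
  have h4 := rA_cont a j
  have h5 := p_cont a i
  have h6 := p_cont a j
  unfold G
  rw [← Lw_smul, ← Lw_smul, ← Lw_smul, ← Lw_smul, ← Lw_add _ _ _ (by fun_prop) (by fun_prop), ← Lw_add _ _ _ (by fun_prop) (by fun_prop)]
  congr 1; funext x
  have e1 := p_rec a (Nat.cast_nonneg a) i x
  have e2 := p_rec a (Nat.cast_nonneg a) j x
  linear_combination p a j x * e1 - p a i x * e2

lemma Lw_zero_l (a : ℕ) (f : ℝ → ℝ) : Lw a (fun x => rA a 0 0 x * f x) = 0 := by simp [Lw, rA]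
lemma Lw_zero_r (a : ℕ) (f : ℝ → ℝ) : Lw a (fun x => f x * rA a 0 0 x) = 0 := by simp [Lw, rA]

lemma G_eq (a i : ℕ) : ∀ j, G a i j = if i = j then 2 else 0 := by
  have hb : ∀ i, b a i ≠ 0 := fun i => (bpos a (Nat.cast_nonneg a) i).ne'
  induction i using Nat.twoStepInduction with
  | zero => exact G_zero a
  | one =>
    intro j
    have h := G_rec a 0 j
    rw [Lw_zero_l, G_zero] at h
    apply mul_left_cancel₀ (hb 1)
    cases j with
    | zero => rw [Lw_zero_r] at h; simp at h ⊢; exact h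
    | succ j =>
      rw [show (fun x => p a 0 x * rA a 0 (j+1) x) = (fun x => p a 0 x * p a j x) from rfl,
        ← G.eq_1, G_zero] at h
      simp at h ⊢
      rw [h]
      by_cases hj : 0 = j
      · subst hj; simp
      · simp [hj, Ne.symm hj]
  | more i ih1 ih2 =>
    intro j
    have h := G_rec a (i+1) j
    rw [show (fun x => rA a 0 (i+1) x * p a j x) = (fun x => p a i x * p a j x) from rfl,
        ← G.eq_1, ih1, ih2] at h
    apply mul_left_cancel₀ (hb (i+2))
    rw [show i + 1 + 1 = i + 2 from rfl] at h
    cases j with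
    | zero =>
      rw [Lw_zero_r] at h
      by_cases hi : i = 0
      · subst hi; simp at h ⊢; exact h
      · simp [hi] at h ⊢; exact h
    | succ j =>
      rw [show (fun x => p a (i+1) x * rA a 0 (j+1) x) = (fun x => p a (i+1) x * p a j x) from rfl,
        ← G.eq_1, ih2] at h
      simp only [Nat.add_right_cancel_iff, show i + 2 = j + 1 ↔ i + 1 = j by omega] at h ⊢
      by_cases h1 : i = j + 1
      · subst h1; simp [show ¬ (j + 1 + 1 = j) by omega] at h ⊢; exact h
      · by_cases h2 : i + 1 = j
        · subst h2; simp [show ¬ (i = i + 1 + 1) by omega] at h ⊢; exact h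
        · simp [h1, h2] at h ⊢; exact h

lemma Y_cont (l : ℕ) (k : ℤ) : Continuous (fun q : ℝ × ℝ => Y l k q.1 q.2) := by
  unfold Y
  have := p_cont (k.natAbs : ℝ) (l - k.natAbs)
  fun_prop

lemma region_int (f : ℝ × ℝ → ℂ) (hf : Continuous f) : IntegrableOn f region := by
  apply hf.continuousOn.integrableOn_compact
  exact isCompact_Icc.prod isCompact_Icc

/-- joint continuity -/
def JC (f : ℝ → ℝ → ℂ) : Prop := Continuous (fun q : ℝ × ℝ => f q.1 q.2)

lemma JC_int (f g : ℝ → ℝ → ℂ) (hf : JC f) (hg : JC g) :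
    IntegrableOn (fun q : ℝ × ℝ => f q.1 q.2 * (starRingEnd ℂ) (g q.1 q.2) * ((Real.sin q.1 : ℝ) : ℂ)) region := by
  apply region_int
  unfold JC at hf hg
  have := Complex.continuous_conj.comp hg
  simp only [Function.comp_def] at this
  fun_prop

lemma inner2_add (f g h : ℝ → ℝ → ℂ) (hf : JC f) (hg : JC g) (hh : JC h) :
    inner2 (fun θ φ => f θ φ + g θ φ) h = inner2 f h + inner2 g h := by
  unfold inner2
  rw [← mul_add, ← integral_add (JC_int f h hf hh) (JC_int g h hg hh)]
  congr 2; funext q; ring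

lemma inner2_smul (c : ℂ) (f h : ℝ → ℝ → ℂ) :
    inner2 (fun θ φ => c * f θ φ) h = c * inner2 f h := by
  unfold inner2
  rw [mul_left_comm c, ← integral_const_mul c]
  congr 2; funext q; ring

lemma inner2_conj (f h : ℝ → ℝ → ℂ) : inner2 f h = (starRingEnd ℂ) (inner2 h f) := by
  unfold inner2
  rw [map_mul, ← integral_conj]
  congr 1
  · rw [show (1 / (4 * (Real.pi : ℂ))) = ((1 / (4 * Real.pi) : ℝ) : ℂ) by push_cast; rfl, Complex.conj_ofReal]
  · congr 1; funext q
    simp only [map_mul, Complex.conj_conj, Complex.conj_ofReal]; ring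

lemma JC_sum (s : Finset ℕ) (c : ℕ → ℂ) (k : ℤ) : JC (fun θ φ => ∑ l ∈ s, c l * Y l k θ φ) := by
  unfold JC
  have := fun l => Y_cont l k
  fun_prop

lemma inner2_sum (s : Finset ℕ) (c : ℕ → ℂ) (k : ℤ) (h : ℝ → ℝ → ℂ) (hh : JC h) :
    inner2 (fun θ φ => ∑ l ∈ s, c l * Y l k θ φ) h = ∑ l ∈ s, c l * inner2 (Y l k) h := by
  classical
  induction s using Finset.induction_on with
  | empty => simp [inner2]
  | insert a s ha ih =>
    simp only [sum_insert ha]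
    rw [inner2_add _ _ _ _ (JC_sum s c k) hh, inner2_smul, ih]
    have := Y_cont a k
    unfold JC
    fun_prop

lemma phi_int (k k' : ℤ) : ∫ φ in Set.Icc (0:ℝ) (2 * Real.pi),
    Complex.exp (Complex.I * (k : ℂ) * (φ : ℂ)) * (starRingEnd ℂ) (Complex.exp (Complex.I * (k' : ℂ) * (φ : ℂ)))
    = if k = k' then 2 * (Real.pi : ℂ) else 0 := by
  have hpi := Real.pi_pos
  have e : ∀ φ : ℝ, Complex.exp (Complex.I * (k : ℂ) * (φ : ℂ)) * (starRingEnd ℂ) (Complex.exp (Complex.I * (k' : ℂ) * (φ : ℂ)))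
     = Complex.exp ((Complex.I * ((k - k' : ℤ) : ℂ)) * (φ : ℂ)) := by
    intro φ
    rw [← Complex.exp_conj, ← Complex.exp_add]
    congr 1
    simp only [map_mul, Complex.conj_I, Complex.conj_ofReal, map_intCast]
    push_cast; ring
  simp only [e]
  rw [integral_Icc_eq_integral_Ioc, ← intervalIntegral.integral_of_le (by positivity)]
  by_cases h : k = k'
  · subst h; simp
  · rw [if_neg h, integral_exp_mul_complex]
    · have : Complex.exp (Complex.I * ((k - k' : ℤ) : ℂ) * ((2 * Real.pi : ℝ) : ℂ)) = 1 := by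
        rw [Complex.exp_eq_one_iff]
        exact ⟨k - k', by push_cast; ring⟩
      rw [this]; simp
    · have : ((k - k' : ℤ) : ℂ) ≠ 0 := by
        rw [Int.cast_ne_zero]; omega
      exact mul_ne_zero Complex.I_ne_zero this

lemma inner_YY (l l' : ℕ) (k k' : ℤ) (hl : k.natAbs ≤ l) (hl' : k'.natAbs ≤ l') :
    inner2 (Y l k) (Y l' k') = if l = l' ∧ k = k' then 1 else 0 := by
  have hpi : (Real.pi : ℂ) ≠ 0 := by exact_mod_cast Real.pi_pos.ne'
  have e : inner2 (Y l k) (Y l' k') = (1 / (4 * Real.pi)) *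
      ((∫ θ in Set.Icc (0:ℝ) Real.pi, ((Real.sin θ ^ k.natAbs * p (k.natAbs : ℝ) (l - k.natAbs) (Real.cos θ) *
        (Real.sin θ ^ k'.natAbs * p (k'.natAbs : ℝ) (l' - k'.natAbs) (Real.cos θ)) * Real.sin θ : ℝ) : ℂ)) *
      ∫ φ in Set.Icc (0:ℝ) (2 * Real.pi), Complex.exp (Complex.I * (k : ℂ) * (φ : ℂ)) *
        (starRingEnd ℂ) (Complex.exp (Complex.I * (k' : ℂ) * (φ : ℂ)))) := by
    rw [← setIntegral_prod_mul]
    unfold inner2 region Y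
    rw [← Measure.volume_eq_prod]
    congr 2; funext q
    simp only [map_mul, Complex.conj_ofReal]
    push_cast; ring
  rw [e, phi_int]
  by_cases hk : k = k'
  · subst hk
    rw [integral_complex_ofReal, integral_Icc_eq_integral_Ioc, ← intervalIntegral.integral_of_le Real.pi_pos.le]
    have : (∫ θ in (0:ℝ)..Real.pi, Real.sin θ ^ k.natAbs * p (k.natAbs : ℝ) (l - k.natAbs) (Real.cos θ) *
        (Real.sin θ ^ k.natAbs * p (k.natAbs : ℝ) (l' - k.natAbs) (Real.cos θ)) * Real.sin θ)
        = G k.natAbs (l - k.natAbs) (l' - k.natAbs) := by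
      unfold G Lw
      congr 1; funext θ; ring
    rw [this, G_eq]
    simp only [show l - k.natAbs = l' - k.natAbs ↔ l = l' by omega, and_true]
    by_cases h : l = l'
    · simp [h]; field_simp; norm_num
    · simp [h]
  · simp [hk]

lemma Pr_sum (n m : ℕ) (k : ℤ) (hk : k.natAbs ≤ m) (c : ℕ → ℂ) :
    Pr n m (fun θ φ => ∑ l ∈ Icc m n, c l * Y l k θ φ) = fun θ φ => ∑ l ∈ Icc m n, c l * Y l k θ φ := by
  funext θ φ
  unfold Pr
  apply sum_congr rfl
  intro l hl
  rw [mem_Icc] at hl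
  have : ∀ k' ∈ Icc (-(l:ℤ)) (l:ℤ), inner2 (fun θ φ => ∑ l ∈ Icc m n, c l * Y l k θ φ) (Y l k') * Y l k' θ φ
     = if k = k' then c l * Y l k θ φ else 0 := by
    intro k' hk'
    rw [mem_Icc] at hk'
    rw [inner2_sum _ _ _ _ (Y_cont l k')]
    have : ∀ i ∈ Icc m n, c i * inner2 (Y i k) (Y l k') = if i = l then (if k = k' then c l else 0) else 0 := by
      intro i hi
      rw [mem_Icc] at hi
      rw [inner_YY _ _ _ _ (by omega) (by omega)]
      by_cases h1 : i = l
      · subst h1; by_cases h2 : k = k' <;> simp [h2]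
      · simp [h1]
    rw [sum_congr rfl this, sum_ite_eq', if_pos (mem_Icc.mpr hl)]
    by_cases h2 : k = k'
    · subst h2; simp
    · simp [h2]
  rw [sum_congr rfl this, sum_ite_eq, if_pos]
  rw [mem_Icc]; omega

/-- for `−m ≤ k ≤ m` and any root `xr` of `p_{n−m+1}^{(|k|)}(·, m−|k|)`, the
function `ψ_{k,i}` lies in `Π_n^m`, has unit norm, is an eigenfunction of `P_n^m M P_n^m`
with eigenvalue `xr`, and has the stated closed form wherever `cos θ ≠ xr`. -/
theorem stmt7 (n m : ℕ) (hmn : m ≤ n) (k : ℤ) (hk : k.natAbs ≤ m) (xr : ℝ)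
    (hroot : pA (k.natAbs : ℝ) (m - k.natAbs) (n - m + 1) xr = 0) :
    psiFun n m k xr ∈ Pi_nm n m ∧
    norm2 (psiFun n m k xr) = 1 ∧
    SFop n m (psiFun n m k xr) = (fun θ φ => ((xr : ℝ) : ℂ) * psiFun n m k xr θ φ) ∧
    (∀ θ φ : ℝ, Real.cos θ ≠ xr →
      psiFun n m k xr θ φ =
        ((kap n m k.natAbs xr : ℝ) : ℂ) * ((Real.sin θ ^ k.natAbs : ℝ) : ℂ) *
          Complex.exp (Complex.I * (k : ℂ) * (φ : ℂ)) *
          ((b (k.natAbs : ℝ) (n - k.natAbs + 1) *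
                pA (k.natAbs : ℝ) (m - k.natAbs) (n - m) xr *
                p (k.natAbs : ℝ) (n - k.natAbs + 1) (Real.cos θ) +
              pZ (k.natAbs : ℝ) ((m : ℤ) - (k.natAbs : ℤ) - 1) (Real.cos θ) : ℝ) : ℂ) /
          (((Real.cos θ : ℝ) : ℂ) - ((xr : ℝ) : ℂ))) := by
  have hα : (0:ℝ) ≤ (k.natAbs : ℝ) := Nat.cast_nonneg _
  obtain ⟨K, hK⟩ : ∃ K, K = k.natAbs := ⟨_, rfl⟩
  have hmax : max k.natAbs m = m := max_eq_right hk
  let c : ℕ → ℂ := fun l => ((kap n m k.natAbs xr : ℝ) : ℂ) * ((pA (k.natAbs : ℝ) (m - k.natAbs) (l - m) xr : ℝ) : ℂ)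
  have hpsi : psiFun n m k xr = fun θ φ => ∑ l ∈ Icc m n, c l * Y l k θ φ := by
    funext θ φ
    unfold psiFun
    rw [hmax, mul_sum]
    apply sum_congr rfl
    intro l _
    simp only [c]; ring
  have hpZ : ∀ y, pZ (k.natAbs : ℝ) ((m : ℤ) - (k.natAbs : ℤ) - 1) y = rA (k.natAbs:ℝ) 0 (m - k.natAbs) y := by
    intro y
    rcases hM : m - k.natAbs with _ | M
    · unfold pZ; rw [if_neg (by omega)]; rfl
    · unfold pZ; rw [if_pos (by omega)]
      rw [show ((m : ℤ) - (k.natAbs : ℤ) - 1).toNat = M by omega]; rfl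
  have hCD : ∀ y, (y - xr) * ∑ l ∈ Icc m n, pA (k.natAbs : ℝ) (m - k.natAbs) (l - m) xr * p (k.natAbs:ℝ) (l - k.natAbs) y
      = b (k.natAbs : ℝ) (n - k.natAbs + 1) * pA (k.natAbs : ℝ) (m - k.natAbs) (n - m) xr *
                p (k.natAbs : ℝ) (n - k.natAbs + 1) y +
              pZ (k.natAbs : ℝ) ((m : ℤ) - (k.natAbs : ℤ) - 1) y := by
    intro y
    have h := CD (k.natAbs:ℝ) hα (m - k.natAbs) (n - m) xr y
    rw [hroot, show m - k.natAbs + (n - m) + 1 = n - k.natAbs + 1 by omega] at h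
    rw [hpZ]
    have hs : ∑ l ∈ Icc m n, pA (k.natAbs : ℝ) (m - k.natAbs) (l - m) xr * p (k.natAbs:ℝ) (l - k.natAbs) y =
       ∑ l ∈ range (n - m + 1), pA (k.natAbs : ℝ) (m - k.natAbs) l xr * p (k.natAbs:ℝ) (m - k.natAbs + l) y := by
      rw [← Finset.Ico_add_one_right_eq_Icc, sum_Ico_eq_sum_range, show n + 1 - m = n - m + 1 by omega]
      apply sum_congr rfl
      intro l _
      rw [show m + l - m = l by omega, show m + l - k.natAbs = m - k.natAbs + l by omega]
    rw [hs, h]; ring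
  have hpsi2 : ∀ θ φ, psiFun n m k xr θ φ = ((kap n m k.natAbs xr : ℝ) : ℂ) * ((Real.sin θ ^ k.natAbs : ℝ) : ℂ) *
          Complex.exp (Complex.I * (k : ℂ) * (φ : ℂ)) *
          ((∑ l ∈ Icc m n, pA (k.natAbs : ℝ) (m - k.natAbs) (l - m) xr * p (k.natAbs:ℝ) (l - k.natAbs) (Real.cos θ) : ℝ) : ℂ) := by
    intro θ φ
    rw [hpsi]
    push_cast
    rw [mul_sum]
    apply sum_congr rfl
    intro l _
    simp only [c, Y]
    push_cast; ring
  refine ⟨?_, ?_, ?_, ?_⟩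
  · have : psiFun n m k xr = ∑ l ∈ Icc m n, c l • Y l k := by
      rw [hpsi]; funext θ φ; simp [Finset.sum_apply]
    rw [this]
    apply Submodule.sum_mem
    intro l hl
    rw [mem_Icc] at hl
    apply Submodule.smul_mem
    apply Submodule.subset_span
    exact ⟨l, k, hl.1, hl.2, by omega, rfl⟩
  · have h1 : inner2 (psiFun n m k xr) (psiFun n m k xr) = ∑ l ∈ Icc m n, c l * (starRingEnd ℂ) (c l) := by
      rw [hpsi, inner2_sum _ _ _ _ (JC_sum _ _ _)]
      apply sum_congr rfl
      intro l hl
      congr 1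
      rw [inner2_conj, inner2_sum _ _ _ _ (Y_cont l k)]
      congr 1
      rw [sum_eq_single_of_mem l hl]
      · rw [mem_Icc] at hl; rw [inner_YY _ _ _ _ (by omega) (by omega)]; simp
      · intro i hi hne
        rw [mem_Icc] at hi hl
        rw [inner_YY _ _ _ _ (by omega) (by omega)]; simp [hne]
    have hpos : 0 < ∑ l ∈ Icc m n, (pA (k.natAbs : ℝ) (m - k.natAbs) (l - m) xr)^2 := by
      apply sum_pos'
      · intro i _; positivity
      · refine ⟨m, by simp [hmn], ?_⟩
        have := bpos (k.natAbs:ℝ) hα (m - k.natAbs)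
        rw [Nat.sub_self, pA]; positivity
    have h2 : inner2 (psiFun n m k xr) (psiFun n m k xr) = ((1:ℝ):ℂ) := by
      have h3 : (1:ℝ) = ∑ l ∈ Icc m n, (kap n m k.natAbs xr)^2 * (pA (k.natAbs : ℝ) (m - k.natAbs) (l - m) xr)^2 := by
        rw [← mul_sum, kap, hmax, inv_pow, Real.sq_sqrt hpos.le, inv_mul_cancel₀ hpos.ne']
      rw [h1, h3]
      push_cast
      apply sum_congr rfl
      intro l _
      simp only [c, map_mul, Complex.conj_ofReal]; ring
    unfold norm2
    rw [h2]; simp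
  · have hP : Pr n m (psiFun n m k xr) = psiFun n m k xr := by rw [hpsi]; exact Pr_sum n m k hk c
    have hJ : JC (psiFun n m k xr) := by rw [hpsi]; exact JC_sum _ _ _
    unfold SFop
    rw [hP]
    let Z : ℝ → ℝ → ℂ := if k.natAbs < m then Y (m-1) k else fun _ _ => 0
    have hZ : JC Z := by
      simp only [Z]; split_ifs
      · exact Y_cont _ _
      · exact continuous_const
    let d : ℂ := ((kap n m k.natAbs xr * b (k.natAbs : ℝ) (n - k.natAbs + 1) * pA (k.natAbs : ℝ) (m - k.natAbs) (n - m) xr : ℝ) : ℂ)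
    have hM : Mop (psiFun n m k xr) = fun θ φ => (xr : ℂ) * psiFun n m k xr θ φ +
        (d * Y (n+1) k θ φ + ((kap n m k.natAbs xr : ℝ) : ℂ) * Z θ φ) := by
      funext θ φ
      have hZe : Z θ φ = ((Real.sin θ ^ k.natAbs : ℝ) : ℂ) *
          ((pZ (k.natAbs : ℝ) ((m : ℤ) - (k.natAbs : ℤ) - 1) (Real.cos θ) : ℝ) : ℂ) *
          Complex.exp (Complex.I * (k : ℂ) * (φ : ℂ)) := by
        simp only [Z]
        split_ifs with h
        · unfold Y pZ; rw [if_pos (by omega), show ((m : ℤ) - (k.natAbs : ℤ) - 1).toNat = m - 1 - k.natAbs by omega]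
        · unfold pZ; rw [if_neg (by omega)]; simp
      have h := congrArg (fun t : ℝ => (t : ℂ)) (hCD (Real.cos θ))
      unfold Mop
      rw [hZe, hpsi2]
      simp only [d, Y]
      rw [show n + 1 - k.natAbs = n - k.natAbs + 1 by omega]
      push_cast at h ⊢
      linear_combination ((kap n m k.natAbs xr : ℝ) : ℂ) * (Complex.sin θ ^ k.natAbs) *
          Complex.exp (Complex.I * (k : ℂ) * (φ : ℂ)) * h
    have hi : ∀ l k', m ≤ l → l ≤ n → k'.natAbs ≤ l →
        inner2 (Mop (psiFun n m k xr)) (Y l k') = (xr : ℂ) * inner2 (psiFun n m k xr) (Y l k') := by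
      intro l k' h1 h2 h3
      have hY := Y_cont (n+1) k
      unfold JC at hZ hJ
      have z : inner2 Z (Y l k') = 0 := by
        simp only [Z]
        split_ifs with h
        · rw [inner_YY _ _ _ _ (by omega) h3, if_neg (by omega)]
        · simp [inner2]
      rw [hM, inner2_add _ _ _ (by unfold JC; fun_prop) (by unfold JC; fun_prop) (Y_cont _ _),
        inner2_add _ _ _ (by unfold JC; fun_prop) (by unfold JC; fun_prop) (Y_cont _ _), inner2_smul, inner2_smul, inner2_smul,
        z, inner_YY _ _ _ _ (by omega) h3, if_neg (by omega)]
      ring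
    funext θ φ
    conv_rhs => rw [← hP]
    unfold Pr
    simp only [mul_sum]
    apply sum_congr rfl
    intro l hl
    apply sum_congr rfl
    intro k' hk'
    rw [mem_Icc] at hl hk'
    rw [hi l k' hl.1 hl.2 (by omega)]
    ring
  · intro θ φ hne
    have hne' : ((Real.cos θ : ℝ) : ℂ) - (xr : ℂ) ≠ 0 := by
      rw [← Complex.ofReal_sub, Complex.ofReal_ne_zero]; exact sub_ne_zero.mpr hne
    rw [← hCD, hpsi2, eq_div_iff hne', Complex.ofReal_mul, Complex.ofReal_sub]
    ring
end SFT
end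
end
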